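/- arXiv:2202.08764 — 2 statements merged into one kernel-verified Lean document; each statement's English description precedes it below -/
import Mathlib

section
/- Let k ≥ 1 and n be positive integers with (3k−2) | n and 3k−2 ≡ 1 or 4 (mod 12). Then ex^lin_4(n, S_k) = n(k−1)/4, where S_k is the linear 4-star with k quadruples. -/
/-- A linear quadruple system on vertex set `Fin n`: a 4-uniform hypergraph in which
every pair of vertices lies in at most one quadruple (equivalently, two distinct
quadruples share at most one vertex). -/
structure LinearQuadSystem (n : ℕ) where
  edges : Finset (Finset (Fin n))
  card_four : ∀ e ∈ edges, e.card = 4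
  linear : ∀ e ∈ edges, ∀ f ∈ edges, e ≠ f → (e ∩ f).card ≤ 1

/-- `H` contains the linear 4-star `S_k`: `k` quadruples through a common vertex `p`
that are otherwise pairwise disjoint. -/
def ContainsStar {n : ℕ} (k : ℕ) (H : LinearQuadSystem n) : Prop :=
  ∃ p : Fin n, ∃ e : Fin k → Finset (Fin n),
    (∀ i, e i ∈ H.edges) ∧ (∀ i, p ∈ e i) ∧
    ∀ i j, i ≠ j → e i ∩ e j = {p}

/-- The blocks have sizes in `K`, and any two distinct points lie in exactly one block. -/
def HasPBD (K : ℕ → Prop) (X : Type) : Prop :=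
  ∃ (I : Type) (B : I → Finset X), (∀ i, K (B i).card) ∧
    ∀ x y, x ≠ y → ∃! i, x ∈ B i ∧ y ∈ B i

/-- `X × Fin 3` carries a group divisible design with blocks of size 4 whose groups are
the fibres of the projection to `X`. -/
def HasGDD (X : Type) : Prop :=
  ∃ (I : Type) (B : I → Finset (X × Fin 3)), (∀ i, (B i).card = 4) ∧
    (∀ i, ∀ p ∈ B i, ∀ q ∈ B i, p.1 = q.1 → p = q) ∧
    ∀ p q, p.1 ≠ q.1 → ∃! i, p ∈ B i ∧ q ∈ B i

theorem HasGDD.of_equiv {P X I : Type} (e : P ≃ X × Fin 3) (B : I → Finset P)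
    (hcard : ∀ i, (B i).card = 4)
    (hinj : ∀ i, ∀ p ∈ B i, ∀ q ∈ B i, (e p).1 = (e q).1 → p = q)
    (hex : ∀ p q, (e p).1 ≠ (e q).1 → ∃! i, p ∈ B i ∧ q ∈ B i) : HasGDD X := by
  refine ⟨I, fun i => (B i).map e.toEmbedding, by simpa using hcard, ?_, ?_⟩
  · intro i p hp q hq hpq
    rw [Finset.mem_map_equiv] at hp hq
    exact e.symm.injective (hinj i _ hp _ hq (by simpa using hpq))
  · intro p q hpq
    simpa only [Finset.mem_map_equiv] using hex (e.symm p) (e.symm q) (by simpa using hpq)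

theorem HasGDD.congr {X Y : Type} (e : X ≃ Y) (h : HasGDD X) : HasGDD Y := by
  obtain ⟨I, B, h1, h2, h3⟩ := h
  exact .of_equiv (e.prodCongr (Equiv.refl _)) B h1
    (fun i p hp q hq h => h2 i p hp q hq (e.injective (by simpa using h)))
    (fun p q h => h3 p q (by simpa using h))

/-- Deleting a point from a Steiner system with blocks of size 4. -/
theorem HasPBD.delete_point {P : Type} [Finite P] (h : HasPBD (· = 4) P) {r : ℕ}
    (hr : Nat.card P = 3 * r + 1) : HasGDD (Fin r) := by
  classical
  have := Fintype.ofFinite P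
  obtain ⟨I, B, hB, hex⟩ := h
  have hne : Nonempty P := by
    by_contra hP
    rw [not_nonempty_iff] at hP
    simp at hr
  obtain ⟨o⟩ := hne
  choose f hf hfu using fun p : {p : P // p ≠ o} => hex o p (Ne.symm p.2)
  let X := {i : I // o ∈ B i}
  let g : {p : P // p ≠ o} → X := fun p => ⟨f p, (hf p).1⟩
  have hg : ∀ p (x : X), g p = x ↔ p.1 ∈ B x.1 := by
    intro p x
    constructor
    · rintro rfl
      exact (hf p).2
    · intro hp
      exact Subtype.ext (hfu p x.1 ⟨x.2, hp⟩).symm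
  have hcard : ∀ x : X, Nat.card {p // g p = x} = 3 := by
    intro x
    have e : {p // g p = x} ≃ ((B x.1).erase o : Finset P) :=
      { toFun := fun p => ⟨p.1.1, Finset.mem_erase.2 ⟨p.1.2, (hg _ _).1 p.2⟩⟩
        invFun := fun p => ⟨⟨p.1, (Finset.mem_erase.1 p.2).1⟩,
          (hg _ _).2 (Finset.mem_erase.1 p.2).2⟩
        left_inv := fun _ => rfl
        right_inv := fun _ => rfl }
    rw [Nat.card_congr e, Nat.card_eq_fintype_card, Fintype.card_coe,
      Finset.card_erase_of_mem x.2, hB]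
  have efib : ∀ x : X, {p // g p = x} ≃ Fin 3 := fun x => Finite.equivFinOfCardEq (hcard x)
  let e : {p : P // p ≠ o} ≃ X × Fin 3 :=
    ((Equiv.sigmaFiberEquiv g).symm.trans (Equiv.sigmaCongrRight efib)).trans
      (Equiv.sigmaEquivProd _ _)
  have he : ∀ p, (e p).1 = g p := fun p => rfl
  have hX : Nat.card X = r := by
    have h1 := Nat.card_congr e
    rw [Nat.card_prod, Nat.card_eq_fintype_card, Fintype.card_subtype_compl,
      Fintype.card_subtype_eq, ← Nat.card_eq_fintype_card, hr] at h1
    simp at h1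
    omega
  have : Finite X := Finite.of_surjective g fun x => by
    have : Nonempty {p // g p = x} := (Nat.card_pos_iff.1 (by rw [hcard x]; norm_num)).1
    obtain ⟨p⟩ := this
    exact ⟨p.1, p.2⟩
  refine HasGDD.congr (Finite.equivFinOfCardEq hX) ?_
  refine HasGDD.of_equiv (I := {i : I // o ∉ B i}) e
    (fun i => (B i.1).subtype (· ≠ o)) ?_ ?_ ?_
  · intro i
    rw [Finset.card_subtype, Finset.filter_true_of_mem, hB]
    rintro x hx rfl
    exact i.2 hx
  · intro i p hp q hq hpq
    rw [he, he] at hpq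
    rw [Finset.mem_subtype] at hp hq
    by_contra hne
    have h1 : p.1 ∈ B (g q).1 := (hg _ _).1 hpq
    have h2 : q.1 ∈ B (g q).1 := (hg _ _).1 rfl
    have h3 := (hex p q (fun h => hne (Subtype.ext h))).unique ⟨hp, hq⟩ ⟨h1, h2⟩
    exact i.2 (h3 ▸ (g q).2)
  · intro p q hpq
    rw [he, he] at hpq
    obtain ⟨i, hi, hiu⟩ := hex p q (fun h => hpq (congrArg g (Subtype.ext h)))
    refine ⟨⟨i, fun ho => hpq ?_⟩, by simpa using hi, ?_⟩
    · rw [(hg p ⟨i, ho⟩).2 hi.1, (hg q ⟨i, ho⟩).2 hi.2]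
    · rintro j hj
      exact Subtype.ext (hiu j.1 (by simpa using hj))

/-- Adding a point at infinity to a group divisible design. -/
theorem HasGDD.add_point {X : Type} (h : HasGDD X) :
    HasPBD (· = 4) (Option (X × Fin 3)) := by
  obtain ⟨I, B, h1, h2, h3⟩ := h
  refine ⟨I ⊕ X, Sum.elim (fun i => (B i).map Function.Embedding.some)
    (fun x => Finset.insertNone ({x} ×ˢ Finset.univ)), ?_, ?_⟩
  · rintro (i | x)
    · simpa using h1 i
    · simp
  · have key : ∀ p q : X × Fin 3, p ≠ q → ∃! i : I ⊕ X,
        some p ∈ Sum.elim (fun i => (B i).map Function.Embedding.some)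
          (fun x => Finset.insertNone ({x} ×ˢ Finset.univ)) i ∧
        some q ∈ Sum.elim (fun i => (B i).map Function.Embedding.some)
          (fun x => Finset.insertNone ({x} ×ˢ Finset.univ)) i := by
      intro p q hpq
      by_cases hx : p.1 = q.1
      · refine ⟨Sum.inr p.1, by simp [hx, -Finset.singleton_product], ?_⟩
        rintro (i | x)
        · simp only [Sum.elim_inl, Finset.mem_map, Function.Embedding.some_apply,
            Option.some.injEq, exists_eq_right]
          rintro ⟨hp, hq⟩
          exact absurd (h2 i p hp q hq hx) hpq
        · simp [-Finset.singleton_product]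
          intro h _
          exact h.symm
      · obtain ⟨i, hi, hiu⟩ := h3 p q hx
        refine ⟨Sum.inl i, by simpa using hi, ?_⟩
        rintro (j | x)
        · intro hj
          rw [hiu j (by simpa using hj)]
        · simp [-Finset.singleton_product]
          intro h h'
          exact absurd (h.trans h'.symm) hx
    rintro (_ | p) (_ | q) hpq
    · exact absurd rfl hpq
    · refine ⟨Sum.inr q.1, by simp, ?_⟩
      rintro (i | x)
      · simp
      · simp [-Finset.singleton_product]
        exact fun h => h.symm
    · refine ⟨Sum.inr p.1, by simp, ?_⟩
      rintro (i | x)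
      · simp
      · simp [-Finset.singleton_product]
        exact fun h => h.symm
    · exact key p q (fun h => hpq (by rw [h]))

/-- Blowing up the points of a pairwise balanced design by a factor of three. -/
theorem HasPBD.hasGDD {X : Type} (h : HasPBD (fun k => HasGDD (Fin k)) X) : HasGDD X := by
  obtain ⟨I, B, hB, hex⟩ := h
  choose J D h1 h2 h3 using fun i => (hB i).congr (B i).equivFin.symm
  let em : ∀ i, (B i) × Fin 3 ↪ X × Fin 3 := fun i =>
    (Function.Embedding.subtype _).prodMap (Function.Embedding.refl _)
  have hem : ∀ i (j : J i) (p : X × Fin 3),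
      p ∈ (D i j).map (em i) ↔ ∃ hp : p.1 ∈ B i, (⟨p.1, hp⟩, p.2) ∈ D i j := by
    intro i j p
    rw [Finset.mem_map]
    constructor
    · rintro ⟨⟨x, a⟩, hx, rfl⟩
      exact ⟨x.2, hx⟩
    · rintro ⟨hp, h⟩
      exact ⟨_, h, rfl⟩
  refine ⟨Σ i, J i, fun t => (D t.1 t.2).map (em t.1), fun t => by simpa using h1 t.1 t.2,
    ?_, ?_⟩
  · rintro ⟨i, j⟩ p hp q hq hpq
    obtain ⟨hp, hp'⟩ := (hem i j p).1 hp
    obtain ⟨hq, hq'⟩ := (hem i j q).1 hq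
    have := h2 i j _ hp' _ hq' (Subtype.ext hpq)
    exact Prod.ext hpq (congrArg (fun t => t.2) this)
  · intro p q hpq
    obtain ⟨i, hi, hiu⟩ := hex p.1 q.1 hpq
    obtain ⟨j, hj, hju⟩ := h3 i (⟨p.1, hi.1⟩, p.2) (⟨q.1, hi.2⟩, q.2)
      (fun h => hpq (congrArg Subtype.val h))
    refine ⟨⟨i, j⟩, ⟨(hem i j p).2 ⟨hi.1, hj.1⟩, (hem i j q).2 ⟨hi.2, hj.2⟩⟩, ?_⟩
    rintro ⟨i', j'⟩ ⟨hp, hq⟩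
    obtain ⟨hp, hp'⟩ := (hem i' j' p).1 hp
    obtain ⟨hq, hq'⟩ := (hem i' j' q).1 hq
    obtain rfl := hiu i' ⟨hp, hq⟩
    obtain rfl := hju j' ⟨hp', hq'⟩
    rfl

theorem HasPBD.mono {K L : ℕ → Prop} {X : Type} (h : HasPBD K X) (hKL : ∀ k, K k → L k) :
    HasPBD L X := by
  obtain ⟨I, B, hB, hex⟩ := h
  exact ⟨I, B, fun i => hKL _ (hB i), hex⟩

theorem hasGDD_zero : HasGDD (Fin 0) :=
  ⟨Empty, Empty.elim, fun i => i.elim, fun i => i.elim, fun p => p.1.elim0⟩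

theorem hasGDD_one : HasGDD (Fin 1) :=
  ⟨Empty, Empty.elim, fun i => i.elim, fun i => i.elim,
    fun _ _ h => absurd (Subsingleton.elim _ _) h⟩

theorem HasGDD.three_mul_add_one {r : ℕ} (h4 : HasGDD (Fin 4)) (h : HasGDD (Fin r)) :
    HasGDD (Fin (3 * r + 1)) := by
  refine HasGDD.congr (Finite.equivFinOfCardEq ?_)
    (h.add_point.mono (L := fun k => HasGDD (Fin k)) ?_).hasGDD
  · simp [mul_comm]
  · rintro _ rfl
    exact h4

/-- The design developed from a relative difference family; the groups are the fibres
of `f`. -/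
theorem exists_design_of_differenceFamily {G X J : Type} [AddCommGroup G] [AddCommGroup X]
    (f : G →+ X) (F : J → Fin 4 → G)
    (hF : ∀ j a b, a ≠ b → f (F j a - F j b) ≠ 0)
    (hd : ∀ d, f d ≠ 0 → ∃! t : J × Fin 4 × Fin 4, F t.1 t.2.1 - F t.1 t.2.2 = d) :
    ∃ B : J × G → Finset G, (∀ i, (B i).card = 4) ∧
      (∀ i, ∀ p ∈ B i, ∀ q ∈ B i, f p = f q → p = q) ∧
      ∀ p q, f p ≠ f q → ∃! i, p ∈ B i ∧ q ∈ B i := by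
  classical
  refine ⟨fun i => Finset.univ.image fun a => F i.1 a + i.2, ?_, ?_, ?_⟩
  · intro i
    rw [Finset.card_image_of_injective]
    · simp
    · intro a b hab
      by_contra hne
      exact hF i.1 a b hne (by simp [add_right_cancel hab])
  · simp only [Finset.mem_image, Finset.mem_univ, true_and]
    rintro ⟨j, g⟩ _ ⟨a, rfl⟩ _ ⟨b, rfl⟩ hab
    by_contra hne
    refine hF j a b (fun h => hne (by rw [h])) ?_
    simpa [sub_eq_zero] using hab
  · simp only [Finset.mem_image, Finset.mem_univ, true_and]
    intro p q hpq
    obtain ⟨⟨j, a, b⟩, ht, hu⟩ := hd (p - q) (by simpa [sub_eq_zero] using hpq)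
    dsimp only at ht
    refine ⟨(j, p - F j a), ⟨⟨a, by simp⟩, b, ?_⟩, ?_⟩
    · rw [add_sub_left_comm, ← sub_sub_cancel p q, ← ht]
      abel
    · rintro ⟨j', g⟩ ⟨⟨a', ha'⟩, b', hb'⟩
      have h := hu (j', a', b') (by simp only [← ha', ← hb', add_sub_add_right_eq_sub])
      simp only [Prod.mk.injEq] at h
      obtain ⟨rfl, rfl, rfl⟩ := h
      simp [← ha']

theorem hasPBD_of_differenceFamily {G J : Type} [AddCommGroup G] (F : J → Fin 4 → G)
    (hF : ∀ j a b, a ≠ b → F j a - F j b ≠ 0)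
    (hd : ∀ d, d ≠ 0 → ∃! t : J × Fin 4 × Fin 4, F t.1 t.2.1 - F t.1 t.2.2 = d) :
    HasPBD (· = 4) G := by
  obtain ⟨B, h1, -, h3⟩ := exists_design_of_differenceFamily (AddMonoidHom.id G) F hF hd
  exact ⟨_, B, h1, h3⟩

theorem hasGDD_of_differenceFamily {X J : Type} [AddCommGroup X]
    (F : J → Fin 4 → X × ZMod 3)
    (hF : ∀ j a b, a ≠ b → (F j a - F j b).1 ≠ 0)
    (hd : ∀ d : X × ZMod 3, d.1 ≠ 0 →
      ∃! t : J × Fin 4 × Fin 4, F t.1 t.2.1 - F t.1 t.2.2 = d) :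
    HasGDD X := by
  obtain ⟨B, h1, h2, h3⟩ :=
    exists_design_of_differenceFamily (AddMonoidHom.fst X (ZMod 3)) F hF hd
  exact ⟨_, B, h1, h2, h3⟩

theorem hasGDD_four : HasGDD (Fin 4) :=
  (hasPBD_of_differenceFamily (G := ZMod 13) (J := Unit) (fun _ => ![0, 1, 3, 9])
    (by decide +kernel) (by unfold ExistsUnique; decide +kernel)).delete_point (by simp)

theorem hasGDD_five : HasGDD (Fin 5) :=
  hasGDD_of_differenceFamily (X := ZMod 5) (J := Unit)
    (fun _ => ![(0, 0), (1, 1), (3, 0), (2, 1)])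
    (by decide +kernel) (by unfold ExistsUnique; decide +kernel)

theorem hasGDD_eight : HasGDD (Fin 8) :=
  (hasPBD_of_differenceFamily (G := ZMod 5 × ZMod 5) (J := Fin 2)
    ![![(0, 0), (0, 1), (1, 0), (2, 2)], ![(0, 0), (0, 2), (2, 0), (4, 4)]]
    (by decide +kernel) (by unfold ExistsUnique; decide +kernel)).delete_point (by simp)

set_option synthInstance.maxSize 1000 in
theorem hasGDD_nine : HasGDD (Fin 9) :=
  (hasGDD_of_differenceFamily (X := ZMod 3 × ZMod 3) (J := Fin 2)
    ![![((0, 0), 0), ((0, 1), 0), ((1, 0), 0), ((1, 1), 1)],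
      ![((0, 0), 0), ((1, 1), 2), ((1, 2), 1), ((2, 0), 1)]]
    (by decide +kernel) (by unfold ExistsUnique; decide +kernel)).congr (Finite.equivFinOfCardEq (by simp))

theorem hasGDD_twelve : HasGDD (Fin 12) :=
  (hasPBD_of_differenceFamily (G := ZMod 37) (J := Fin 3)
    ![![0, 1, 3, 24], ![0, 10, 18, 30], ![0, 4, 26, 32]]
    (by decide +kernel) (by unfold ExistsUnique; decide +kernel)).delete_point (by simp)

/-- The pairwise balanced design obtained from a transversal design with five groups
given by four slopes over a ring: truncate the last group to `H` and adjoin the points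
of `E` to every group. -/
theorem hasPBD_of_slopes {A E : Type} [CommRing A] [Fintype A] [Fintype E] [Subsingleton E]
    (c : Fin 4 → A) (hc : ∀ i j, i ≠ j → IsUnit (c i - c j)) (H : Finset A) :
    HasPBD (fun k => k = 4 ∨ k = 5 ∨ k = Fintype.card E + Fintype.card A ∨
      k = Fintype.card E + H.card) (E ⊕ (Fin 4 × A) ⊕ H) := by
  classical
  let line : A × A → Finset (E ⊕ (Fin 4 × A) ⊕ H) := fun l =>
    Finset.disjSum ∅ (Finset.disjSum (Finset.univ.image fun i => (i, l.1 + c i * l.2))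
      (Finset.univ.filter fun z => z.1 = l.2))
  let group : Option (Fin 4) → Finset (E ⊕ (Fin 4 × A) ⊕ H) := fun o =>
    Finset.disjSum Finset.univ (o.elim (Finset.disjSum ∅ Finset.univ)
      fun i => Finset.disjSum ({i} ×ˢ Finset.univ) ∅)
  refine ⟨(A × A) ⊕ Option (Fin 4), Sum.elim line group, ?_, ?_⟩
  · rintro (l | _ | i)
    · have h1 : (Finset.univ.image fun i : Fin 4 => (i, l.1 + c i * l.2)).card = 4 := by
        rw [Finset.card_image_of_injective _ fun a b h => congrArg Prod.fst h]
        simp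
      have h2 : (Finset.univ.filter fun z : H => z.1 = l.2).card ≤ 1 :=
        Finset.card_le_one.2 fun a ha b hb => Subtype.ext (by simp_all)
      simp only [Sum.elim_inl, line, Finset.card_disjSum, h1, Finset.card_empty]
      omega
    · simp [group]
    · simp [group]
  · have huniq : ∀ i j, i ≠ j → ∀ a b, ∃! l : A × A,
        l.1 + c i * l.2 = a ∧ l.1 + c j * l.2 = b := by
      intro i j hij a b
      obtain ⟨u, hu⟩ := hc i j hij
      have hinv : (c i - c j) * ↑u⁻¹ = 1 := by rw [← hu]; simp
      refine ⟨(a - c i * (↑u⁻¹ * (a - b)), ↑u⁻¹ * (a - b)), ⟨by ring, ?_⟩, ?_⟩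
      · linear_combination (b - a) * hinv
      · rintro ⟨x, y⟩ ⟨h1, h2⟩
        dsimp only at h1 h2
        have hy : y = ↑u⁻¹ * (a - b) := by
          rw [← h1, ← h2]
          linear_combination -y * hinv
        rw [← hy, ← h1]
        simp
    rintro (e | ⟨i, a⟩ | z) (e' | ⟨j, b⟩ | w) hne
    · exact absurd (congrArg Sum.inl (Subsingleton.elim e e')) hne
    · refine ⟨Sum.inr (some j), by simp [group], ?_⟩
      rintro (l | _ | i) <;> simp [line, group, eq_comm]
    · refine ⟨Sum.inr none, by simp [group], ?_⟩
      rintro (l | _ | i) <;> simp [line, group]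
    · refine ⟨Sum.inr (some i), by simp [group], ?_⟩
      rintro (l | _ | i) <;> simp [line, group, eq_comm]
    · by_cases hij : i = j
      · subst hij
        refine ⟨Sum.inr (some i), by simp [group], ?_⟩
        rintro (l | _ | i')
        · simp only [Sum.elim_inl, line, Finset.inr_mem_disjSum, Finset.inl_mem_disjSum,
            Finset.mem_image, Finset.mem_univ, true_and, Prod.mk.injEq, exists_eq_left]
          rintro ⟨h1, h2⟩
          exact absurd (by rw [← h1, ← h2]) hne
        · simp [group]
        · simp [group, eq_comm]
      · obtain ⟨l, hl, hlu⟩ := huniq i j hij a b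
        refine ⟨Sum.inl l, by simpa [line] using hl, ?_⟩
        rintro (l' | _ | i')
        · intro h
          rw [hlu l' (by simpa [line] using h)]
        · simp [group]
        · simp [group]
          rintro rfl rfl
          exact hij rfl
    · refine ⟨Sum.inl (a - c i * w, w), by simp [line], ?_⟩
      rintro (⟨x, y⟩ | _ | i')
      · simp [line]
        rintro rfl rfl
        simp
      · simp [group]
      · simp [group]
    · refine ⟨Sum.inr none, by simp [group], ?_⟩
      rintro (l | _ | i) <;> simp [line, group]
    · refine ⟨Sum.inl (b - c j * z, z), by simp [line], ?_⟩
      rintro (⟨x, y⟩ | _ | i')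
      · simp [line]
        rintro rfl rfl
        simp
      · simp [group]
      · simp [group]
    · refine ⟨Sum.inr none, by simp [group], ?_⟩
      rintro (l | _ | i)
      · simp [line]
        intro h1 h2
        exact absurd (congrArg (fun t => Sum.inr (Sum.inr t)) (Subtype.ext (h1.trans h2.symm)))
          hne
      · simp
      · simp [group]

theorem hasGDD_of_slopes {A E : Type} [CommRing A] [Fintype A] [Fintype E] [Subsingleton E]
    (c : Fin 4 → A) (hc : ∀ i j, i ≠ j → IsUnit (c i - c j)) {h : ℕ}
    (hle : h ≤ Fintype.card A) (hA : HasGDD (Fin (Fintype.card E + Fintype.card A)))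
    (hH : HasGDD (Fin (Fintype.card E + h))) :
    HasGDD (Fin (Fintype.card E + (4 * Fintype.card A + h))) := by
  obtain ⟨H, -, rfl⟩ := Finset.exists_subset_card_eq (s := (Finset.univ : Finset A)) hle
  refine ((hasPBD_of_slopes (E := E) c hc H).mono ?_).hasGDD.congr
    (Finite.equivFinOfCardEq ?_)
  · rintro k (rfl | rfl | rfl | rfl)
    exacts [hasGDD_four, hasGDD_five, hA, hH]
  · simp

theorem hasGDD_of_field {A : Type} [Field A] [Fintype A] (h4 : 4 ≤ Fintype.card A) {h : ℕ}
    (hle : h ≤ Fintype.card A) (hA : HasGDD (Fin (Fintype.card A))) (hH : HasGDD (Fin h)) :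
    HasGDD (Fin (4 * Fintype.card A + h)) := by
  obtain ⟨c⟩ := Function.Embedding.nonempty_of_card_le
    (α := Fin 4) (β := A) (by simpa using h4)
  have := hasGDD_of_slopes (E := Empty) c
    (fun i j hij => (sub_ne_zero.2 (c.injective.ne hij)).isUnit) hle
    (by simpa using hA) (by simpa using hH)
  simpa using this

theorem exists_zmod_slopes {t : ℕ} (ht : Nat.Coprime t 6) :
    ∃ c : Fin 4 → ZMod t, ∀ i j, i ≠ j → IsUnit (c i - c j) := by
  have h6 : IsUnit ((6 : ℕ) : ZMod t) := (ZMod.isUnit_iff_coprime 6 t).2 ht.symm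
  have h1 : IsUnit (1 : ZMod t) := isUnit_one
  have h2 : IsUnit (2 : ZMod t) := isUnit_of_dvd_unit ⟨3, by norm_num⟩ h6
  have h3 : IsUnit (3 : ZMod t) := isUnit_of_dvd_unit ⟨2, by norm_num⟩ h6
  refine ⟨![0, 1, 2, 3], fun i j hij => ?_⟩
  fin_cases i <;> fin_cases j <;> first | exact absurd rfl hij | (norm_num; done) | (norm_num; assumption)

theorem hasGDD_four_mul {t e h : ℕ} (ht : t % 6 = 1 ∨ t % 6 = 5) (he : e ≤ 1) (hle : h ≤ t)
    (hA : HasGDD (Fin (e + t))) (hH : HasGDD (Fin (e + h))) :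
    HasGDD (Fin (e + (4 * t + h))) := by
  have hcop : Nat.Coprime t 6 := by
    rw [Nat.Coprime, Nat.gcd_comm, Nat.gcd_rec]
    rcases ht with ht | ht <;> rw [ht] <;> rfl
  have : NeZero t := ⟨by omega⟩
  have : Subsingleton (Fin e) := Fin.subsingleton_iff_le_one.2 he
  obtain ⟨c, hc⟩ := exists_zmod_slopes hcop
  have := hasGDD_of_slopes (E := Fin e) (h := h) c hc
  simp only [ZMod.card, Fintype.card_fin] at this
  exact this hle hA hH

theorem hasGDD_fin (r : ℕ) (hr : r % 4 = 0 ∨ r % 4 = 1) : HasGDD (Fin r) := by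
  induction r using Nat.strong_induction_on with
  | _ r ih =>
  have step : ∀ t e, (t % 6 = 1 ∨ t % 6 = 5) → (e = 0 ∧ t % 4 = 1 ∨ e = 1 ∧ t % 4 = 3) →
      e + 4 * t ≤ r → r ≤ e + 5 * t → HasGDD (Fin r) := by
    intro t e ht he h1 h2
    have h := hasGDD_four_mul (e := e) (h := r - (e + 4 * t)) ht (by omega) (by omega)
      (ih _ (by omega) (by omega)) (ih _ (by omega) (by omega))
    rwa [show e + (4 * t + (r - (e + 4 * t))) = r by omega] at h
  have triple : ∀ s, r = 3 * s + 1 → (s % 4 = 0 ∨ s % 4 = 1) → 0 < s → HasGDD (Fin r) := by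
    rintro s rfl hs h0
    exact hasGDD_four.three_mul_add_one (ih s (by omega) hs)
  have galois : ∀ p n h [Fact p.Prime], n ≠ 0 → 4 ≤ p ^ n → h ≤ p ^ n → p ^ n % 4 ≤ 1 →
      h % 4 ≤ 1 → r = 4 * p ^ n + h → HasGDD (Fin r) := by
    intro p n h _ hn h4 hle hq hh hr
    have : Fintype (GaloisField p n) := Fintype.ofFinite _
    have hcard : Fintype.card (GaloisField p n) = p ^ n := by
      rw [← Nat.card_eq_fintype_card, GaloisField.card p n hn]
    have := hasGDD_of_field (A := GaloisField p n) (h := h) (by omega) (by omega)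
      (ih _ (by omega) (by omega)) (ih _ (by omega) (by omega))
    rwa [hcard, ← hr] at this
  rcases lt_or_ge r 80 with hlt | hge
  · by_cases h5 : 20 ≤ r ∧ r ≤ 25
    · exact step 5 0 (by norm_num) (by norm_num) (by omega) (by omega)
    by_cases h7 : 29 ≤ r ∧ r ≤ 36
    · exact step 7 1 (by norm_num) (by norm_num) (by omega) (by omega)
    by_cases h11 : 45 ≤ r ∧ r ≤ 56
    · exact step 11 1 (by norm_num) (by norm_num) (by omega) (by omega)
    by_cases h13 : 52 ≤ r ∧ r ≤ 65
    · exact step 13 0 (by norm_num) (by norm_num) (by omega) (by omega)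
    by_cases h17 : 68 ≤ r
    · exact step 17 0 (by norm_num) (by norm_num) (by omega) (by omega)
    have hr' : r = 0 ∨ r = 1 ∨ r = 4 ∨ r = 5 ∨ r = 8 ∨ r = 9 ∨ r = 12 ∨
        (r = 13 ∨ r = 16 ∨ r = 28 ∨ r = 37 ∨ r = 40) ∨ r = 17 ∨ r = 41 ∨ r = 44 := by
      omega
    rcases hr' with rfl | rfl | rfl | rfl | rfl | rfl | rfl | h | h | h | h
    · exact hasGDD_zero
    · exact hasGDD_one
    · exact hasGDD_four
    · exact hasGDD_five
    · exact hasGDD_eight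
    · exact hasGDD_nine
    · exact hasGDD_twelve
    · exact triple ((r - 1) / 3) (by omega) (by omega) (by omega)
    · exact galois 2 2 1 (by norm_num) (by norm_num) (by norm_num) (by norm_num) (by norm_num) h
    · exact galois 3 2 5 (by norm_num) (by norm_num) (by norm_num) (by norm_num) (by norm_num) h
    · exact galois 3 2 8 (by norm_num) (by norm_num) (by norm_num) (by norm_num) (by norm_num) h
  · obtain ⟨t, ht, h1, h2⟩ : ∃ t, (t % 6 = 1 ∨ t % 6 = 5) ∧ 4 * t + 1 ≤ r ∧ r ≤ 5 * t := by
      have : ∃ d < 4, ((r - 1) / 4 - d) % 6 = 1 ∨ ((r - 1) / 4 - d) % 6 = 5 := by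
        have h6 : 6 ≤ (r - 1) / 4 := by omega
        generalize (r - 1) / 4 = q at h6
        have : q % 6 < 6 := Nat.mod_lt _ (by norm_num)
        interval_cases hq : q % 6
        exacts [⟨1, by omega⟩, ⟨0, by omega⟩, ⟨1, by omega⟩, ⟨2, by omega⟩, ⟨3, by omega⟩,
          ⟨0, by omega⟩]
      obtain ⟨d, hd, h⟩ := this
      exact ⟨(r - 1) / 4 - d, h, by omega, by omega⟩
    obtain h4 | h4 : t % 4 = 1 ∨ t % 4 = 3 := by omega
    · exact step t 0 ht (Or.inl ⟨rfl, h4⟩) (by omega) (by omega)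
    · exact step t 1 ht (Or.inr ⟨rfl, h4⟩) (by omega) (by omega)

namespace LinearQuadSystem

variable {n : ℕ}

def degree (H : LinearQuadSystem n) (p : Fin n) : ℕ := (H.edges.filter (p ∈ ·)).card

theorem sum_degree (H : LinearQuadSystem n) : ∑ p, H.degree p = 4 * H.edges.card := by
  have h := Finset.sum_card_bipartiteAbove_eq_sum_card_bipartiteBelow
    (s := (Finset.univ : Finset (Fin n))) (t := H.edges) (fun p e => p ∈ e)
  simp only [Finset.bipartiteAbove, Finset.bipartiteBelow, Finset.filter_univ_mem] at h
  rw [Finset.sum_congr rfl H.card_four] at h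
  simpa [degree, mul_comm] using h

theorem containsStar_iff_exists_le_degree (H : LinearQuadSystem n) (k : ℕ) :
    ContainsStar k H ↔ ∃ p, k ≤ H.degree p := by
  constructor
  · rintro ⟨p, e, he, hp, hint⟩
    refine ⟨p, ?_⟩
    have hinj : Function.Injective e := by
      intro i j hij
      by_contra hne
      have h1 := hint i j hne
      rw [← hij, Finset.inter_self] at h1
      have h2 := H.card_four _ (he i)
      simp [h1] at h2
    calc k = (Finset.univ.map ⟨e, hinj⟩).card := by simp
      _ ≤ _ := Finset.card_le_card fun x hx => by
        obtain ⟨i, -, rfl⟩ := Finset.mem_map.1 hx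
        exact Finset.mem_filter.2 ⟨he i, hp i⟩
  · rintro ⟨p, hp⟩
    obtain ⟨S, hS, hcard⟩ := Finset.exists_subset_card_eq hp
    let e := (S.equivFinOfCardEq hcard).symm
    have he : ∀ i, (e i).1 ∈ H.edges ∧ p ∈ (e i).1 := fun i =>
      Finset.mem_filter.1 (hS (e i).2)
    refine ⟨p, fun i => (e i).1, fun i => (he i).1, fun i => (he i).2, fun i j hij => ?_⟩
    refine (Finset.eq_of_subset_of_card_le ?_ ?_).symm
    · simp [(he i).2, (he j).2]
    · simpa using H.linear _ (he i).1 _ (he j).1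
        (fun h => hij (e.injective (Subtype.ext h)))

end LinearQuadSystem

/-- Disjoint copies of a Steiner system form a regular linear quadruple system. -/
theorem HasPBD.exists_linearQuadSystem {P : Type} [Finite P] (h : HasPBD (· = 4) P) {n c : ℕ}
    (hn : n = c * Nat.card P) :
    ∃ H : LinearQuadSystem n, ∀ v, 3 * H.degree v + 1 = Nat.card P := by
  classical
  have := Fintype.ofFinite P
  obtain ⟨I, B, hB, hex⟩ := h
  let σ : Fin n ≃ Fin c × P :=
    (Finite.equivFinOfCardEq (α := Fin c × P) (by simp [hn])).symm
  let block : Fin c → I → Finset (Fin n) := fun a i =>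
    ((B i).map ⟨Prod.mk a, Prod.mk_right_injective a⟩).map σ.symm.toEmbedding
  have hmem : ∀ a i v, v ∈ block a i ↔ (σ v).1 = a ∧ (σ v).2 ∈ B i := by
    intro a i v
    simp only [block, Finset.mem_map_equiv, Equiv.symm_symm]
    simp only [Finset.mem_map, Function.Embedding.coeFn_mk]
    constructor
    · rintro ⟨x, hx, h⟩
      rw [← h]
      exact ⟨rfl, hx⟩
    · rintro ⟨rfl, h⟩
      exact ⟨_, h, rfl⟩
  have huniq : ∀ a i a' i' v w, v ≠ w → v ∈ block a i → w ∈ block a i →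
      v ∈ block a' i' → w ∈ block a' i' → block a i = block a' i' := by
    intro a i a' i' v w hne hv hw hv' hw'
    rw [hmem] at hv hw hv' hw'
    obtain rfl := hv.1.symm.trans hv'.1
    rw [(hex (σ v).2 (σ w).2 fun h => hne (σ.injective
      (Prod.ext (hv.1.trans hw.1.symm) h))).unique ⟨hv.2, hw.2⟩ ⟨hv'.2, hw'.2⟩]
  let H : LinearQuadSystem n :=
    { edges := Finset.univ.filter fun e => ∃ a i, e = block a i
      card_four := by
        intro e he
        obtain ⟨a, i, rfl⟩ := (Finset.mem_filter.1 he).2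
        simpa [block] using hB i
      linear := by
        intro e he f hf hne
        obtain ⟨a, i, rfl⟩ := (Finset.mem_filter.1 he).2
        obtain ⟨a', i', rfl⟩ := (Finset.mem_filter.1 hf).2
        refine Finset.card_le_one.2 fun v hv w hw => ?_
        rw [Finset.mem_inter] at hv hw
        by_contra hvw
        exact hne (huniq a i a' i' v w hvw hv.1 hw.1 hv.2 hw.2) }
  refine ⟨H, fun v => ?_⟩
  have hS : ∀ e ∈ H.edges.filter (v ∈ ·), v ∈ e ∧ ∃ a i, e = block a i := by
    intro e he
    have h := Finset.mem_filter.1 he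
    exact ⟨h.2, (Finset.mem_filter.1 h.1).2⟩
  have hunion : (H.edges.filter (v ∈ ·)).biUnion (fun e => e.erase v) =
      (((Finset.univ : Finset P).erase (σ v).2).map
        ⟨Prod.mk (σ v).1, Prod.mk_right_injective _⟩).map σ.symm.toEmbedding := by
    ext w
    simp only [Finset.mem_biUnion, Finset.mem_map_equiv, Equiv.symm_symm]
    simp only [Finset.mem_map, Function.Embedding.coeFn_mk, Finset.mem_erase, Finset.mem_univ, and_true]
    constructor
    · rintro ⟨e, he, hne, hw⟩
      obtain ⟨hv, a, i, rfl⟩ := hS e he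
      rw [hmem] at hv hw
      have h1 : (σ v).1 = (σ w).1 := hv.1.trans hw.1.symm
      exact ⟨(σ w).2, fun h => hne (σ.injective (Prod.ext h1.symm h)), Prod.ext h1 rfl⟩
    · rintro ⟨x, hx, h⟩
      obtain ⟨i, hi, -⟩ := hex (σ v).2 x hx.symm
      refine ⟨block (σ v).1 i, Finset.mem_filter.2
        ⟨Finset.mem_filter.2 ⟨Finset.mem_univ _, _, _, rfl⟩, ?_⟩, ?_, ?_⟩
      · exact (hmem _ _ _).2 ⟨rfl, hi.1⟩
      · rintro rfl
        exact hx (congrArg Prod.snd h)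
      · rw [hmem, ← h]
        exact ⟨rfl, hi.2⟩
  have hcard := congrArg Finset.card hunion
  rw [Finset.card_biUnion, Finset.sum_congr rfl (g := fun _ => 3)] at hcard
  · simp only [Finset.sum_const, smul_eq_mul, Finset.card_map,
      Finset.card_erase_of_mem (Finset.mem_univ _), Finset.card_univ,
      ← Nat.card_eq_fintype_card] at hcard
    have : 0 < Nat.card P := Nat.card_pos_iff.2 ⟨⟨(σ v).2⟩, inferInstance⟩
    rw [LinearQuadSystem.degree]
    omega
  · intro e he
    rw [Finset.card_erase_of_mem (hS e he).1, H.card_four e (Finset.mem_filter.1 he).1]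
  · intro e he f hf hne
    rw [Function.onFun, Finset.disjoint_left]
    intro w hwe hwf
    rw [Finset.mem_erase] at hwe hwf
    obtain ⟨hv, a, i, rfl⟩ := hS e he
    obtain ⟨hv', a', i', rfl⟩ := hS f hf
    exact hne (huniq a i a' i' v w hwe.1.symm hv hwe.2 hv' hwf.2)

/-- if `(3k-2) ∣ n` and `3k-2 ≡ 1, 4 (mod 12)`, then
`ex^lin_4(n, S_k) = n(k-1)/4` (stated via `4 · |E(H)|` to avoid division). -/
theorem linear_turan_star (k n : ℕ) (hk : 1 ≤ k) (hn : 0 < n)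
    (hdvd : (3 * k - 2) ∣ n) (hmod : (3 * k - 2) % 12 = 1 ∨ (3 * k - 2) % 12 = 4) :
    (∀ H : LinearQuadSystem n, ¬ ContainsStar k H → 4 * H.edges.card ≤ n * (k - 1)) ∧
    (∃ H : LinearQuadSystem n, ¬ ContainsStar k H ∧ 4 * H.edges.card = n * (k - 1)) := by
  constructor
  · intro H hH
    rw [H.containsStar_iff_exists_le_degree, not_exists] at hH
    rw [← H.sum_degree]
    refine (Finset.sum_le_card_nsmul _ _ (k - 1) fun p _ => ?_).trans (by simp)
    have := hH p
    omega
  · obtain ⟨c, rfl⟩ := hdvd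
    have hP : Nat.card (Option (Fin (k - 1) × Fin 3)) = 3 * k - 2 := by
      simp
      omega
    obtain ⟨H, hH⟩ := (hasGDD_fin (k - 1) (by omega)).add_point.exists_linearQuadSystem
      (n := (3 * k - 2) * c) (c := c) (by rw [hP, mul_comm])
    have hdeg : ∀ v, H.degree v = k - 1 := fun v => by
      have := hH v
      omega
    refine ⟨H, ?_, ?_⟩
    · rw [H.containsStar_iff_exists_le_degree]
      rintro ⟨p, hp⟩
      rw [hdeg] at hp
      omega
    · rw [← H.sum_degree]
      simp [hdeg]
end

section
/- If H is a P_3-free linear quadruple system on n vertices with exactly n quadruples, then H is a vertex-disjoint union of copies of the Steiner system S(2,4,13); in particular every connected component of H is an S(2,4,13) on 13 vertices in which every vertex has degree 4. -/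
/-- `H` contains the linear 4-path `P_k`: quadruples `e 0, …, e (k-1)` with consecutive
quadruples meeting in exactly one vertex and non-consecutive quadruples disjoint. -/
def ContainsPath {n : ℕ} (k : ℕ) (H : LinearQuadSystem n) : Prop :=
  ∃ e : Fin k → Finset (Fin n),
    (∀ i, e i ∈ H.edges) ∧
    (∀ i j : Fin k, (i : ℕ) + 1 = (j : ℕ) → (e i ∩ e j).card = 1) ∧
    (∀ i j : Fin k, (i : ℕ) + 2 ≤ (j : ℕ) → e i ∩ e j = ∅)

namespace LinearQuadSystem

variable {n : ℕ} (H : LinearQuadSystem n)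

/-- The quadruples through a vertex. -/
def star (v : Fin n) : Finset (Finset (Fin n)) := H.edges.filter (fun e => v ∈ e)

/-- The vertices lying on a common quadruple with `v`. -/
def hull (v : Fin n) : Finset (Fin n) := (H.star v).biUnion id

variable {H}

lemma mem_star {v : Fin n} {e : Finset (Fin n)} : e ∈ H.star v ↔ e ∈ H.edges ∧ v ∈ e := by
  simp [star]

lemma mem_hull {v x : Fin n} : x ∈ H.hull v ↔ ∃ e ∈ H.edges, v ∈ e ∧ x ∈ e := by
  simp [hull, mem_star, and_assoc]

lemma eq_of_mem {e f : Finset (Fin n)} {x y : Fin n} (he : e ∈ H.edges) (hf : f ∈ H.edges)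
    (hxy : x ≠ y) (hxe : x ∈ e) (hye : y ∈ e) (hxf : x ∈ f) (hyf : y ∈ f) : e = f := by
  by_contra hne
  exact hxy (Finset.card_le_one.mp (H.linear e he f hf hne) x (Finset.mem_inter.mpr ⟨hxe, hxf⟩)
    y (Finset.mem_inter.mpr ⟨hye, hyf⟩))

/-- In a `P_3`-free system, meeting is a transitive relation on quadruples. -/
lemma meet_trans (hfree : ¬ ContainsPath 3 H) {e f g : Finset (Fin n)} (he : e ∈ H.edges)
    (hf : f ∈ H.edges) (hg : g ∈ H.edges) (hef : (e ∩ f).Nonempty) (hfg : (f ∩ g).Nonempty) :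
    (e ∩ g).Nonempty := by
  by_contra hne
  rw [Finset.not_nonempty_iff_eq_empty] at hne
  have h1 : e ≠ f := by rintro rfl; simp [hne] at hfg
  have h2 : f ≠ g := by rintro rfl; simp [hne] at hef
  refine hfree ⟨![e, f, g], ?_, ?_, ?_⟩
  · intro i; fin_cases i <;> simp [he, hf, hg]
  · intro i j hij
    have c1 : (e ∩ f).card = 1 := le_antisymm (H.linear e he f hf h1) hef.card_pos
    have c2 : (f ∩ g).card = 1 := le_antisymm (H.linear f hf g hg h2) hfg.card_pos
    fin_cases i <;> fin_cases j <;> simp_all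
  · intro i j hij
    fin_cases i <;> fin_cases j <;> simp_all

/-- If a quadruple avoiding `v` meets a quadruple through `v`, then it meets all of them, in
distinct vertices. -/
lemma card_star_le (hfree : ¬ ContainsPath 3 H) {e f : Finset (Fin n)} {v : Fin n}
    (he : e ∈ H.edges) (hf : f ∈ H.edges) (hve : v ∈ e) (hvf : v ∉ f)
    (hef : (e ∩ f).Nonempty) : (H.star v).card ≤ (f ∩ H.hull v).card := by
  have key : ∀ g ∈ H.star v, ∃ p, p ∈ g ∧ p ∈ f := by
    intro g hg
    obtain ⟨hg, hvg⟩ := mem_star.mp hg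
    obtain ⟨p, hp⟩ := meet_trans hfree hg he hf ⟨v, Finset.mem_inter.mpr ⟨hvg, hve⟩⟩ hef
    exact ⟨p, Finset.mem_inter.mp hp⟩
  have : Nonempty (Fin n) := ⟨v⟩
  choose! p hpg hpf using key
  refine Finset.card_le_card_of_injOn p ?_ ?_
  · intro g hg
    obtain ⟨hg', hvg⟩ := mem_star.mp hg
    exact Finset.mem_inter.mpr ⟨hpf g hg, mem_hull.mpr ⟨g, hg', hvg, hpg g hg⟩⟩
  · intro g hg g' hg' hpp
    obtain ⟨h1, hvg⟩ := mem_star.mp hg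
    obtain ⟨h2, hvg'⟩ := mem_star.mp hg'
    refine eq_of_mem h1 h2 (fun hvp => hvf ?_) hvg (hpg g hg) hvg' (hpp ▸ hpg g' hg')
    rw [hvp]
    exact hpf g hg

lemma card_star_pos {e : Finset (Fin n)} {v : Fin n} (he : e ∈ H.edges) (hv : v ∈ e) :
    0 < (H.star v).card :=
  Finset.card_pos.mpr ⟨e, mem_star.mpr ⟨he, hv⟩⟩

/-- A quadruple containing a vertex of degree at least five has no other vertex of degree
greater than one. -/
lemma card_star_eq_one (hfree : ¬ ContainsPath 3 H) {e : Finset (Fin n)} {u v : Fin n}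
    (he : e ∈ H.edges) (hv : v ∈ e) (hu : u ∈ e) (huv : u ≠ v) (hdeg : 4 < (H.star v).card) :
    (H.star u).card = 1 := by
  rw [Finset.card_eq_one]
  refine ⟨e, Finset.eq_singleton_iff_unique_mem.mpr ⟨mem_star.mpr ⟨he, hu⟩, fun f hf => ?_⟩⟩
  obtain ⟨hf, huf⟩ := mem_star.mp hf
  by_cases hvf : v ∈ f
  · exact eq_of_mem hf he huv huf hvf hu hv
  · have h1 := card_star_le hfree he hf hv hvf ⟨u, Finset.mem_inter.mpr ⟨hu, huf⟩⟩
    have h2 := Finset.card_le_card (Finset.inter_subset_left (s₁ := f) (s₂ := H.hull v))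
    have h3 := H.card_four f hf
    omega

/-- The reciprocal degrees along a quadruple sum to more than one as soon as some vertex of the
quadruple has degree at least five. -/
lemma one_lt_sum_inv_of_four_lt (hfree : ¬ ContainsPath 3 H) {e : Finset (Fin n)} {v : Fin n}
    (he : e ∈ H.edges) (hv : v ∈ e) (hdeg : 4 < (H.star v).card) :
    1 < ∑ u ∈ e, ((H.star u).card : ℚ)⁻¹ := by
  obtain ⟨u, hu, huv⟩ := Finset.exists_mem_ne (by rw [H.card_four e he]; norm_num) v
  have hsub : ({u, v} : Finset (Fin n)) ⊆ e := by
    simp [Finset.insert_subset_iff, hu, hv]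
  refine lt_of_lt_of_le ?_
    (Finset.sum_le_sum_of_subset_of_nonneg hsub fun _ _ _ => by positivity)
  rw [Finset.sum_pair huv, card_star_eq_one hfree he hv hu huv hdeg]
  have : (0 : ℚ) < (H.star v).card := by exact_mod_cast card_star_pos he hv
  simpa using this

lemma quarter_le_inv {e : Finset (Fin n)} {u : Fin n} (he : e ∈ H.edges) (hu : u ∈ e)
    (hdeg : (H.star u).card ≤ 4) : (4 : ℚ)⁻¹ ≤ ((H.star u).card : ℚ)⁻¹ :=
  inv_anti₀ (by exact_mod_cast card_star_pos he hu) (by exact_mod_cast hdeg)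

lemma one_le_sum_inv (hfree : ¬ ContainsPath 3 H) {e : Finset (Fin n)} (he : e ∈ H.edges) :
    1 ≤ ∑ u ∈ e, ((H.star u).card : ℚ)⁻¹ := by
  by_cases hdeg : ∃ v ∈ e, 4 < (H.star v).card
  · obtain ⟨v, hv, hdeg⟩ := hdeg
    exact (one_lt_sum_inv_of_four_lt hfree he hv hdeg).le
  · push Not at hdeg
    calc (1 : ℚ) = ∑ _u ∈ e, (4 : ℚ)⁻¹ := by simp [H.card_four e he]
      _ ≤ _ := Finset.sum_le_sum fun u hu => quarter_le_inv he hu (hdeg u hu)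

lemma card_star_eq_four_of_sum_inv (hfree : ¬ ContainsPath 3 H) {e : Finset (Fin n)}
    (he : e ∈ H.edges) (hsum : ∑ u ∈ e, ((H.star u).card : ℚ)⁻¹ = 1) {v : Fin n} (hv : v ∈ e) :
    (H.star v).card = 4 := by
  have hdeg : ∀ u ∈ e, (H.star u).card ≤ 4 := by
    intro u hu
    by_contra! hlt
    exact (one_lt_sum_inv_of_four_lt hfree he hu hlt).ne' hsum
  have heq : ∑ _u ∈ e, (4 : ℚ)⁻¹ = ∑ u ∈ e, ((H.star u).card : ℚ)⁻¹ := by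
    simp [hsum, H.card_four e he]
  have := (Finset.sum_eq_sum_iff_of_le fun u hu => quarter_le_inv he hu (hdeg u hu)).mp heq v hv
  exact_mod_cast (inv_injective this).symm

lemma sum_sum_inv :
    ∑ e ∈ H.edges, ∑ u ∈ e, ((H.star u).card : ℚ)⁻¹
      = ∑ u : Fin n, if (H.star u).card = 0 then 0 else 1 := by
  rw [Finset.sum_comm' (t' := Finset.univ) (s' := H.star) (by simp [mem_star])]
  refine Finset.sum_congr rfl fun u _ => ?_
  split_ifs with h
  · simp [h]
  · rw [Finset.sum_const, nsmul_eq_mul, mul_inv_cancel₀ (by exact_mod_cast h)]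

/-- A `P_3`-free system with as many quadruples as vertices is `4`-regular. -/
lemma card_star_eq_four (hfree : ¬ ContainsPath 3 H) (hcard : H.edges.card = n) (v : Fin n) :
    (H.star v).card = 4 := by
  have hle : ∀ u ∈ (Finset.univ : Finset (Fin n)),
      (if (H.star u).card = 0 then (0 : ℚ) else 1) ≤ 1 := by
    intro u _; split_ifs <;> norm_num
  have hlow : ∑ _e ∈ H.edges, (1 : ℚ) ≤ ∑ e ∈ H.edges, ∑ u ∈ e, ((H.star u).card : ℚ)⁻¹ :=
    Finset.sum_le_sum fun e he => one_le_sum_inv hfree he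
  have hupp := Finset.sum_le_sum hle
  have htot : ∑ _e ∈ H.edges, (1 : ℚ) = ∑ _u : Fin n, 1 := by simp [hcard]
  rw [sum_sum_inv] at hlow
  have hpos := (Finset.sum_eq_sum_iff_of_le hle).mp (le_antisymm hupp (htot ▸ hlow)) v
    (Finset.mem_univ v)
  have hne : (H.star v).Nonempty := by
    rw [← Finset.card_ne_zero]
    intro h0
    simp [h0] at hpos
  obtain ⟨e, he⟩ := hne
  obtain ⟨he, hve⟩ := mem_star.mp he
  have heq : ∑ _e ∈ H.edges, (1 : ℚ) = ∑ e ∈ H.edges, ∑ u ∈ e, ((H.star u).card : ℚ)⁻¹ := by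
    rw [sum_sum_inv]
    exact le_antisymm hlow (htot ▸ hupp)
  exact card_star_eq_four_of_sum_inv hfree he
    ((Finset.sum_eq_sum_iff_of_le fun e he => one_le_sum_inv hfree he).mp heq e he).symm hve

lemma mem_hull_symm {x y : Fin n} (h : x ∈ H.hull y) : y ∈ H.hull x := by
  obtain ⟨e, he, hy, hx⟩ := mem_hull.mp h
  exact mem_hull.mpr ⟨e, he, hx, hy⟩

lemma self_mem_hull {v : Fin n} (hdeg : (H.star v).card = 4) : v ∈ H.hull v := by
  obtain ⟨e, he⟩ := Finset.card_pos.mp (by omega : 0 < (H.star v).card)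
  obtain ⟨he, hv⟩ := mem_star.mp he
  exact mem_hull.mpr ⟨e, he, hv, hv⟩

lemma card_hull {v : Fin n} (hdeg : (H.star v).card = 4) : (H.hull v).card = 13 := by
  have hunion : H.hull v = insert v ((H.star v).biUnion fun e => e.erase v) := by
    ext x
    by_cases hx : x = v
    · subst hx; simp [self_mem_hull hdeg]
    · simp [hx, mem_hull, mem_star, and_assoc]
  have hdisj : ∀ e ∈ H.star v, ∀ f ∈ H.star v, e ≠ f → Disjoint (e.erase v) (f.erase v) := by
    intro e he f hf hne
    obtain ⟨he, hve⟩ := mem_star.mp he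
    obtain ⟨hf, hvf⟩ := mem_star.mp hf
    refine Finset.disjoint_left.mpr fun x hxe hxf => hne ?_
    obtain ⟨hxv, hxe⟩ := Finset.mem_erase.mp hxe
    exact eq_of_mem he hf hxv hxe hve (Finset.mem_of_mem_erase hxf) hvf
  have hthree : ∀ e ∈ H.star v, (e.erase v).card = 3 := by
    intro e he
    obtain ⟨he, hve⟩ := mem_star.mp he
    rw [Finset.card_erase_of_mem hve, H.card_four e he]
  rw [hunion, Finset.card_insert_of_notMem (by simp), Finset.card_biUnion hdisj,
    Finset.sum_congr rfl hthree]
  simp [hdeg]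

/-- A quadruple meeting the hull of a vertex of degree four lies inside that hull. -/
lemma subset_hull (hfree : ¬ ContainsPath 3 H) {f : Finset (Fin n)} {v y : Fin n}
    (hdeg : (H.star v).card = 4) (hf : f ∈ H.edges) (hyf : y ∈ f) (hy : y ∈ H.hull v) :
    f ⊆ H.hull v := by
  by_cases hvf : v ∈ f
  · exact fun x hx => mem_hull.mpr ⟨f, hf, hvf, hx⟩
  · obtain ⟨e, he, hve, hye⟩ := mem_hull.mp hy
    have h1 := card_star_le hfree he hf hve hvf ⟨y, Finset.mem_inter.mpr ⟨hye, hyf⟩⟩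
    have h2 := H.card_four f hf
    exact Finset.inter_eq_left.mp
      (Finset.eq_of_subset_of_card_le Finset.inter_subset_left (by omega))

lemma hull_eq_of_mem (hfree : ¬ ContainsPath 3 H) (hdeg : ∀ v, (H.star v).card = 4)
    {x v : Fin n} (hx : x ∈ H.hull v) : H.hull x = H.hull v := by
  have hsub : ∀ {x v : Fin n}, x ∈ H.hull v → H.hull x ⊆ H.hull v := by
    intro x v hx z hz
    obtain ⟨f, hf, hxf, hzf⟩ := mem_hull.mp hz
    exact subset_hull hfree (hdeg v) hf hxf hx hzf
  exact (hsub hx).antisymm (hsub (mem_hull_symm hx))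

end LinearQuadSystem

/-- a `P_3`-free linear quadruple system on `n` vertices with exactly `n`
quadruples is a vertex-disjoint union of copies of the Steiner system `S(2,4,13)`:
the vertex set splits into pairwise disjoint 13-element classes, every quadruple lies
inside one class, within each class every pair of vertices lies in exactly one
quadruple of `H`, and every vertex has degree 4. -/
theorem linear_turan_P3_extremal (n : ℕ) (H : LinearQuadSystem n)
    (hfree : ¬ ContainsPath 3 H) (hcard : H.edges.card = n) :
    ∃ P : Finset (Finset (Fin n)),
      (∀ A ∈ P, A.card = 13) ∧
      (∀ A ∈ P, ∀ B ∈ P, A ≠ B → Disjoint A B) ∧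
      P.biUnion id = Finset.univ ∧
      (∀ e ∈ H.edges, ∃ A ∈ P, e ⊆ A) ∧
      (∀ A ∈ P, ∀ x ∈ A, ∀ y ∈ A, x ≠ y →
        ∃! e : Finset (Fin n), e ∈ H.edges ∧ e ⊆ A ∧ x ∈ e ∧ y ∈ e) ∧
      (∀ v : Fin n, (H.edges.filter (fun e => v ∈ e)).card = 4) := by
  have hdeg := LinearQuadSystem.card_star_eq_four hfree hcard
  refine ⟨Finset.univ.image H.hull, ?_, ?_, ?_, ?_, ?_, hdeg⟩
  · intro A hA
    obtain ⟨v, -, rfl⟩ := Finset.mem_image.mp hA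
    exact LinearQuadSystem.card_hull (hdeg v)
  · intro A hA B hB hne
    obtain ⟨v, -, rfl⟩ := Finset.mem_image.mp hA
    obtain ⟨w, -, rfl⟩ := Finset.mem_image.mp hB
    refine Finset.disjoint_left.mpr fun x hxv hxw => hne ?_
    rw [← LinearQuadSystem.hull_eq_of_mem hfree hdeg hxv,
      LinearQuadSystem.hull_eq_of_mem hfree hdeg hxw]
  · refine Finset.eq_univ_of_forall fun v => Finset.mem_biUnion.mpr
      ⟨H.hull v, Finset.mem_image_of_mem _ (Finset.mem_univ v), ?_⟩
    exact LinearQuadSystem.self_mem_hull (hdeg v)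
  · intro e he
    obtain ⟨v, hv⟩ := Finset.card_pos.mp (by rw [H.card_four e he]; norm_num : 0 < e.card)
    exact ⟨H.hull v, Finset.mem_image_of_mem _ (Finset.mem_univ v),
      fun x hx => LinearQuadSystem.mem_hull.mpr ⟨e, he, hv, hx⟩⟩
  · intro A hA x hx y hy hxy
    obtain ⟨v, -, rfl⟩ := Finset.mem_image.mp hA
    have hyx := hy
    rw [← LinearQuadSystem.hull_eq_of_mem hfree hdeg hx] at hyx
    obtain ⟨e, he, hxe, hye⟩ := LinearQuadSystem.mem_hull.mp hyx
    refine ⟨e, ⟨he, LinearQuadSystem.subset_hull hfree (hdeg v) he hxe hx, hxe, hye⟩, ?_⟩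
    rintro f ⟨hf, -, hxf, hyf⟩
    exact LinearQuadSystem.eq_of_mem hf he hxy hxf hyf hxe hye
end
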